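/- Let G be a finite simple graph, let g, f be integer-valued functions on V(G) with 0 ≤ g(x) ≤ f(x) for every vertex x, and let n', m be non-negative integers. Then G is a fractional (g,f,n',m)-critical deleted graph if and only if for every pair of disjoint vertex subsets S, T ⊆ V(G) with |S| ≥ n', for every U ⊆ S with |U| = n', and for every set H of m edges of G − U, we have f(S) − g(T) + d_{G−S}(T) ≥ f(U) + d_H(T) − e_H(T,S). -/

import Mathlib

open Classical Finset

/-- The fractional degree `d_G^h(x)` of a vertex: the sum of `h e` over all edges
(unordered pairs) containing `x`. -/
noncomputable def fracDeg {V : Type*} [Fintype V] [DecidableEq V]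
    (h : Sym2 V → ℝ) (x : V) : ℝ :=
  ∑ e ∈ Finset.univ.filter (fun e : Sym2 V => x ∈ e), h e

/-- `G` admits a fractional `(g,f)`-factor: a weighting `h : E(G) → [0,1]`
(extended by `0` off the edge set) with `g x ≤ d_G^h(x) ≤ f x` for every vertex. -/
def HasFracFactor {V : Type*} [Fintype V] [DecidableEq V]
    (G : SimpleGraph V) (g f : V → ℤ) : Prop :=
  ∃ h : Sym2 V → ℝ,
    (∀ e, 0 ≤ h e ∧ h e ≤ 1) ∧
    (∀ e, e ∉ G.edgeSet → h e = 0) ∧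
    (∀ x : V, (g x : ℝ) ≤ fracDeg h x ∧ fracDeg h x ≤ (f x : ℝ))

/-- `G` is a fractional `(g,f,m)`-deleted graph: after deleting any `m` edges,
the resulting graph admits a fractional `(g,f)`-factor. -/
def FracDeleted {V : Type*} [Fintype V] [DecidableEq V]
    (G : SimpleGraph V) (g f : V → ℤ) (m : ℕ) : Prop :=
  ∀ H : Finset (Sym2 V), ↑H ⊆ G.edgeSet → H.card = m →
    HasFracFactor (G.deleteEdges ↑H) g f

/-- `G` is a fractional `(g,f,n',m)`-critical deleted graph: after deleting any `n'`
vertices, the resulting induced graph is a fractional `(g,f,m)`-deleted graph. -/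
def FracCriticalDeleted {V : Type*} [Fintype V] [DecidableEq V]
    (G : SimpleGraph V) (g f : V → ℤ) (n' m : ℕ) : Prop :=
  ∀ U : Finset V, U.card = n' →
    FracDeleted (G.induce ((↑U : Set V)ᶜ)) (fun x => g x.1) (fun x => f x.1) m

/-- `G` is a fractional ID-`(g,f,m)`-deleted graph: after deleting any independent set
of vertices, the resulting induced graph is a fractional `(g,f,m)`-deleted graph. -/
def FracIDDeleted {V : Type*} [Fintype V] [DecidableEq V]
    (G : SimpleGraph V) (g f : V → ℤ) (m : ℕ) : Prop :=
  ∀ I : Set V, (∀ u ∈ I, ∀ v ∈ I, ¬ G.Adj u v) →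
    FracDeleted (G.induce Iᶜ) (fun x => g x.1) (fun x => f x.1) m

/-- The edges containing `x` are the pairs `s(x, y)`. -/
lemma fracDeg_eq_sum {V : Type*} [Fintype V] [DecidableEq V] (h : Sym2 V → ℝ) (x : V) :
    fracDeg h x = ∑ y, h s(x, y) := by
  unfold fracDeg
  symm
  refine Finset.sum_bij (fun y _ => s(x, y)) ?_ ?_ ?_ ?_
  · intro y _
    simp
  · exact fun a _ b _ hab => Sym2.congr_right.1 hab
  · intro e he
    obtain ⟨y, rfl⟩ := Sym2.mem_iff_exists.1 (Finset.mem_filter.1 he).2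
    exact ⟨y, Finset.mem_univ _, rfl⟩
  · intro y _
    rfl

/-- The number of neighbours of `x` outside `S`. -/
noncomputable def outDegree {V : Type*} (G : SimpleGraph V) (S : Finset V) (x : V) : ℕ :=
  {y | G.Adj x y ∧ y ∉ S}.ncard

lemma outDegree_eq_card {V : Type*} [Fintype V] (G : SimpleGraph V) (S : Finset V) (x : V) :
    outDegree G S x = (univ.filter fun y => G.Adj x y ∧ y ∉ S).card := by
  rw [outDegree, ← Set.ncard_coe_finset]
  congr 1
  ext y
  simp

lemma outDegree_eq_sum {V : Type*} [Fintype V] (G : SimpleGraph V) (S : Finset V) (x : V) :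
    (outDegree G S x : ℝ) = ∑ y, if G.Adj x y ∧ y ∉ S then (1 : ℝ) else 0 := by
  simp [outDegree_eq_card]

lemma HasFracFactor.cut_nonneg {V : Type*} [Fintype V] [DecidableEq V]
    {G : SimpleGraph V} {g f : V → ℤ} (hG : HasFracFactor G g f)
    (S T : Finset V) :
    0 ≤ (∑ x ∈ S, f x) - (∑ x ∈ T, g x)
      + ∑ x ∈ T, (outDegree G S x : ℤ) := by
  obtain ⟨h, h01, h0, hd⟩ := hG
  simp only [fracDeg_eq_sum] at hd
  have hT : ∑ x ∈ T, (g x : ℝ) ≤ ∑ x ∈ T, ∑ y, h s(x, y) := sum_le_sum fun x _ => (hd x).1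
  have hS : ∑ x ∈ S, ∑ y, h s(x, y) ≤ ∑ x ∈ S, (f x : ℝ) := sum_le_sum fun x _ => (hd x).2
  have hsplit : ∑ x ∈ T, ∑ y, h s(x, y) ≤ ∑ x ∈ T, ((∑ y ∈ S, h s(x, y))
      + (outDegree G S x : ℝ)) := by
    refine sum_le_sum fun x _ => ?_
    rw [outDegree_eq_sum, ← Finset.sum_filter_add_sum_filter_not univ (· ∈ S)]
    have : (univ.filter (· ∈ S) : Finset V) = S := by ext; simp
    rw [this]
    refine add_le_add le_rfl ?_
    rw [Finset.sum_filter]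
    refine sum_le_sum fun y _ => ?_
    by_cases hy : y ∈ S
    · simp [hy]
    · by_cases ha : G.Adj x y
      · simpa [hy, ha] using (h01 _).2
      · simp [hy, ha, h0 s(x, y) (by simpa using ha)]
  have hswap : ∑ x ∈ T, ∑ y ∈ S, h s(x, y) ≤ ∑ x ∈ S, ∑ y, h s(x, y) := by
    rw [Finset.sum_comm]
    refine sum_le_sum fun y _ => ?_
    simp_rw [Sym2.eq_swap (b := y)]
    exact sum_le_sum_of_subset_of_nonneg (subset_univ _) fun _ _ _ => (h01 _).1
  rw [sum_add_distrib] at hsplit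
  have : (0 : ℝ) ≤ (∑ x ∈ S, (f x : ℝ)) - (∑ x ∈ T, (g x : ℝ))
      + ∑ x ∈ T, (outDegree G S x : ℝ) := by linarith
  exact_mod_cast this

/-- The cut condition, averaged over the level sets of a weight function `w`. -/
lemma weighted_cut_nonneg {V : Type*} [Fintype V] (G : SimpleGraph V) (g f : V → ℤ)
    (hcut : ∀ S T : Finset V, Disjoint S T → 0 ≤ (∑ x ∈ S, f x) - (∑ x ∈ T, g x)
      + ∑ x ∈ T, (outDegree G S x : ℤ)) (w : V → ℝ) :
    0 ≤ (∑ x, (f x : ℝ) * max (-w x) 0) - (∑ x, (g x : ℝ) * max (w x) 0)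
      + ∑ x, ∑ y, if G.Adj x y then max (w x - max 0 (-w y)) 0 else 0 := by
  have hint (a b : ℝ) : MeasureTheory.Integrable ((Set.Ico a b).indicator (1 : ℝ → ℝ)) :=
    (MeasureTheory.integrable_indicator_iff measurableSet_Ico).2
      (MeasureTheory.integrableOn_const (by simp))
  have hval (a b : ℝ) : ∫ t, (Set.Ico a b).indicator (1 : ℝ → ℝ) t = max (b - a) 0 := by
    rw [MeasureTheory.integral_indicator_one measurableSet_Ico, Real.volume_real_Ico]
  have hpos (t : ℝ) : 0 ≤ (∑ x, (f x : ℝ) * (Set.Ico 0 (-w x)).indicator (1 : ℝ → ℝ) t)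
      - (∑ x, (g x : ℝ) * (Set.Ico 0 (w x)).indicator (1 : ℝ → ℝ) t)
      + ∑ x, ∑ y, (if G.Adj x y then 1 else 0) *
        (Set.Ico (max 0 (-w y)) (w x)).indicator (1 : ℝ → ℝ) t := by
    by_cases ht : 0 ≤ t
    · have hdisj : Disjoint (univ.filter fun x => t < -w x) (univ.filter fun x => t < w x) := by
        rw [Finset.disjoint_filter]
        intro x _ h1 h2
        linarith
      have h := hcut _ _ hdisj
      have h' : (0 : ℝ) ≤ (∑ x ∈ univ.filter fun x => t < -w x, (f x : ℝ))
          - (∑ x ∈ univ.filter fun x => t < w x, (g x : ℝ))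
          + ∑ x ∈ univ.filter fun x => t < w x, (outDegree G (univ.filter fun x => t < -w x) x : ℝ) := by exact_mod_cast h
      simp only [outDegree_eq_sum, Finset.sum_filter] at h'
      convert h' using 1
      congr 1
      · congr 1
        · refine sum_congr rfl fun x _ => ?_
          simp [Set.indicator, ht]
        · refine sum_congr rfl fun x _ => ?_
          simp [Set.indicator, ht]
      · refine sum_congr rfl fun x _ => ?_
        by_cases hx : t < w x
        · rw [if_pos hx]
          refine sum_congr rfl fun y _ => ?_
          by_cases ha : G.Adj x y <;> simp [Set.indicator, ht, ha, hx]
        · simp [hx]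
    · have h0 (a b : ℝ) (ha : 0 ≤ a) : (Set.Ico a b).indicator (1 : ℝ → ℝ) t = 0 :=
        Set.indicator_of_notMem (fun h => ht (ha.trans h.1)) _
      simp [h0]
  have h := MeasureTheory.integral_nonneg (μ := MeasureTheory.volume) (Pi.le_def.2 hpos)
  have i1 (c a b : ℝ) : MeasureTheory.Integrable
      (fun t => c * (Set.Ico a b).indicator (1 : ℝ → ℝ) t) := (hint a b).const_mul c
  have s1 : MeasureTheory.Integrable
      (fun t => ∑ x, (f x : ℝ) * (Set.Ico 0 (-w x)).indicator (1 : ℝ → ℝ) t) :=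
    MeasureTheory.integrable_finsetSum _ fun x _ => i1 _ _ _
  have s2 : MeasureTheory.Integrable
      (fun t => ∑ x, (g x : ℝ) * (Set.Ico 0 (w x)).indicator (1 : ℝ → ℝ) t) :=
    MeasureTheory.integrable_finsetSum _ fun x _ => i1 _ _ _
  have s3 (x : V) : MeasureTheory.Integrable (fun t => ∑ y, (if G.Adj x y then (1 : ℝ) else 0) *
        (Set.Ico (max 0 (-w y)) (w x)).indicator (1 : ℝ → ℝ) t) :=
    MeasureTheory.integrable_finsetSum _ fun y _ => i1 _ _ _
  have s12 : MeasureTheory.Integrable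
      (fun t => (∑ x, (f x : ℝ) * (Set.Ico 0 (-w x)).indicator (1 : ℝ → ℝ) t)
        - ∑ x, (g x : ℝ) * (Set.Ico 0 (w x)).indicator (1 : ℝ → ℝ) t) := s1.sub s2
  rw [MeasureTheory.integral_add s12 (MeasureTheory.integrable_finsetSum _ fun x _ => s3 x),
    MeasureTheory.integral_sub s1 s2, MeasureTheory.integral_finsetSum _ (fun x _ => i1 _ _ _),
    MeasureTheory.integral_finsetSum _ (fun x _ => i1 _ _ _),
    MeasureTheory.integral_finsetSum _ (fun x _ => s3 x)] at h
  simp_rw [MeasureTheory.integral_finsetSum _ (fun y _ => i1 _ _ _),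
    MeasureTheory.integral_const_mul, hval] at h
  simpa using h

lemma positive_part_add_split (a b : ℝ) :
    max (a - max 0 (-b)) 0 + max (b - max 0 (-a)) 0 = if 0 < a + b then a + b else 0 := by
  grind

lemma two_mul_sum_mul_sum {V : Type*} [Fintype V] (w : V → ℝ) (h : Sym2 V → ℝ) :
    2 * ∑ x, w x * ∑ y, h s(x, y) = ∑ x, ∑ y, (w x + w y) * h s(x, y) := by
  have h1 : ∑ x, w x * ∑ y, h s(x, y) = ∑ x, ∑ y, w x * h s(x, y) := by simp_rw [mul_sum]
  have h2 : ∑ x, w x * ∑ y, h s(x, y) = ∑ x, ∑ y, w y * h s(x, y) := by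
    rw [h1, sum_comm]
    simp_rw [Sym2.eq_swap]
  simp_rw [add_mul, sum_add_distrib]
  rw [← h1, ← h2, two_mul]

/-- The fractional `(g,f)`-factor theorem, sufficiency: separate the compact convex set of
fractional degree sequences from the box `[g,f]`. -/
lemma hasFracFactor_of_cut_nonneg {V : Type*} [Fintype V] [DecidableEq V]
    (G : SimpleGraph V) (g f : V → ℤ) (hgf : ∀ x, g x ≤ f x)
    (hcut : ∀ S T : Finset V, Disjoint S T → 0 ≤ (∑ x ∈ S, f x) - (∑ x ∈ T, g x)
      + ∑ x ∈ T, (outDegree G S x : ℤ)) :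
    HasFracFactor G g f := by
  set K : Set (Sym2 V → ℝ) := Set.Icc 0 (fun e => if e ∈ G.edgeSet then 1 else 0)
  let D : (Sym2 V → ℝ) →ₗ[ℝ] (V → ℝ) :=
    { toFun := fun h x => ∑ y, h s(x, y)
      map_add' := fun h k => by ext x; simp [sum_add_distrib]
      map_smul' := fun c h => by ext x; simp [mul_sum] }
  have hDc : Continuous D := LinearMap.continuous_of_finiteDimensional D
  set B : Set (V → ℝ) := Set.Icc (fun x => (g x : ℝ)) (fun x => (f x : ℝ))
  have hKc : IsCompact (D '' K) := isCompact_Icc.image hDc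
  have hKv : Convex ℝ (D '' K) := (convex_Icc _ _).linear_image D
  by_cases hdis : Disjoint (D '' K) B
  · exfalso
    obtain ⟨φ, u, v, hu, huv, hv⟩ :=
      geometric_hahn_banach_compact_closed hKv hKc (convex_Icc _ _) isClosed_Icc hdis
    set w : V → ℝ := fun x => φ (Pi.single x 1)
    have hφ (d : V → ℝ) : φ d = ∑ x, w x * d x := by
      conv_lhs => rw [pi_eq_sum_univ' d]
      rw [map_sum]
      refine sum_congr rfl fun x _ => ?_
      rw [map_smul, smul_eq_mul, mul_comm]
    let s : Sym2 V → ℝ := Sym2.lift ⟨fun x y => w x + w y, fun x y => add_comm _ _⟩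
    let k : Sym2 V → ℝ := fun e => if e ∈ G.edgeSet ∧ 0 < s e then 1 else 0
    have hk : k ∈ K := by
      refine ⟨fun e => ?_, fun e => ?_⟩
      · simp only [k, Pi.zero_apply]
        split_ifs <;> norm_num
      · simp only [k]
        split_ifs with h1 h2 h2
        exacts [le_rfl, absurd h1.1 h2, zero_le_one, le_rfl]
    let b : V → ℝ := fun x => if 0 < w x then g x else f x
    have hgf' (x : V) : (g x : ℝ) ≤ f x := by exact_mod_cast hgf x
    have hb : b ∈ B := by
      refine ⟨fun x => ?_, fun x => ?_⟩ <;> simp only [b] <;> split_ifs <;>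
        first | exact le_rfl | exact hgf' x
    have h1 := hu _ (Set.mem_image_of_mem D hk)
    have h2 := hv _ hb
    have h3 := weighted_cut_nonneg G g f hcut w
    have hb' : φ b = (∑ x, (g x : ℝ) * max (w x) 0) - ∑ x, (f x : ℝ) * max (-w x) 0 := by
      rw [hφ, ← sum_sub_distrib]
      refine sum_congr rfl fun x _ => ?_
      simp only [b]
      split_ifs with hx
      · rw [max_eq_left hx.le, max_eq_right (by linarith)]; ring
      · rw [max_eq_right (not_lt.1 hx), max_eq_left (by linarith)]; ring
    have hk' : φ (D k) = ∑ x, ∑ y, if G.Adj x y then max (w x - max 0 (-w y)) 0 else 0 := by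
      have e1 : 2 * φ (D k) = ∑ x, ∑ y, (w x + w y) * k s(x, y) := by
        rw [hφ]
        exact two_mul_sum_mul_sum w k
      set c : V → V → ℝ := fun x y => if G.Adj x y then max (w x - max 0 (-w y)) 0 else 0
      have e2 : ∑ x, ∑ y, (w x + w y) * k s(x, y) = ∑ x, ∑ y, (c x y + c y x) := by
        refine sum_congr rfl fun x _ => sum_congr rfl fun y _ => ?_
        simp only [k, s, c, SimpleGraph.mem_edgeSet, Sym2.lift_mk, G.adj_comm y x]
        by_cases ha : G.Adj x y
        · simp [ha, positive_part_add_split]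
        · simp [ha]
      have e3 : ∑ x, ∑ y, c y x = ∑ x, ∑ y, c x y := sum_comm
      simp_rw [sum_add_distrib] at e2
      linarith
    linarith
  · obtain ⟨_, ⟨h, hh, rfl⟩, hd⟩ := Set.not_disjoint_iff.1 hdis
    refine ⟨h, fun e => ⟨hh.1 e, (hh.2 e).trans ?_⟩, fun e he => le_antisymm ?_ (hh.1 e),
      fun x => ?_⟩
    · beta_reduce
      split_ifs <;> norm_num
    · simpa [he] using hh.2 e
    · rw [fracDeg_eq_sum]
      exact ⟨hd.1 x, hd.2 x⟩

/-- Effect of deleting the edges `H` on the cut degree. -/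
lemma sum_card_deleteEdges {V : Type*} [Fintype V] [DecidableEq V] (G : SimpleGraph V)
    (H : Finset (Sym2 V)) (hH : ↑H ⊆ G.edgeSet) (S T : Finset V) (hST : Disjoint S T) :
    ∑ x ∈ T, (outDegree (G.deleteEdges ↑H) S x : ℤ)
      = ∑ x ∈ T, (outDegree G S x : ℤ)
        - ∑ x ∈ T, ((H.filter (fun e => x ∈ e)).card : ℤ)
        + ((H.filter (fun e => ∃ u ∈ T, ∃ v ∈ S, e = s(u, v))).card : ℤ) := by
  have hinj (x : V) : Function.Injective (fun y => s(x, y)) := fun a b hab => Sym2.congr_right.1 hab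
  have hU : H.filter (fun e => ∃ u ∈ T, ∃ v ∈ S, e = s(u, v))
      = T.biUnion fun x => H.filter fun e => ∃ v ∈ S, e = s(x, v) := by
    ext e
    simp only [mem_filter, mem_biUnion]
    tauto
  rw [hU, Finset.card_biUnion]
  · push_cast
    rw [← sum_sub_distrib, ← sum_add_distrib]
    refine sum_congr rfl fun x _ => ?_
    have c1 : (H.filter fun e => x ∈ e).card = (univ.filter fun y => s(x, y) ∈ H).card := by
      rw [← Finset.card_image_of_injective _ (hinj x)]
      congr 1
      ext e
      simp only [mem_filter, mem_image, mem_univ, true_and]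
      constructor
      · rintro ⟨he, hx⟩
        obtain ⟨y, rfl⟩ := Sym2.mem_iff_exists.1 hx
        exact ⟨y, he, rfl⟩
      · rintro ⟨y, hy, rfl⟩
        exact ⟨hy, by simp⟩
    have c2 : (H.filter fun e => ∃ v ∈ S, e = s(x, v)).card
        = (univ.filter fun y => s(x, y) ∈ H ∧ y ∈ S).card := by
      rw [← Finset.card_image_of_injective _ (hinj x)]
      congr 1
      ext e
      simp only [mem_filter, mem_image, mem_univ, true_and]
      constructor
      · rintro ⟨he, v, hv, rfl⟩
        exact ⟨v, ⟨he, hv⟩, rfl⟩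
      · rintro ⟨y, ⟨hy, hS⟩, rfl⟩
        exact ⟨hy, y, hS, rfl⟩
    rw [c1, c2]
    simp only [outDegree_eq_card, Finset.card_filter, Nat.cast_sum, ← sum_sub_distrib, ← sum_add_distrib]
    refine sum_congr rfl fun y _ => ?_
    have : s(x, y) ∈ H → G.Adj x y := fun h => hH h
    by_cases h1 : s(x, y) ∈ H <;> by_cases h2 : y ∈ S <;> by_cases h3 : G.Adj x y <;> simp_all
  · intro x hx y hy hxy
    simp only [Function.onFun]
    rw [Finset.disjoint_filter]
    rintro e _ ⟨v, hv, rfl⟩ ⟨v', hv', h⟩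
    rcases Sym2.eq_iff.1 h with ⟨h, _⟩ | ⟨_, h⟩
    · exact hxy h
    · exact Finset.disjoint_left.1 hST hv (h ▸ hy)

lemma hasFracFactor_iff {V : Type*} [Fintype V] [DecidableEq V]
    (G : SimpleGraph V) (g f : V → ℤ) (hgf : ∀ x, g x ≤ f x) :
    HasFracFactor G g f ↔ ∀ S T : Finset V, Disjoint S T →
      0 ≤ (∑ x ∈ S, f x) - (∑ x ∈ T, g x)
        + ∑ x ∈ T, (outDegree G S x : ℤ) :=
  ⟨fun h S T _ => h.cut_nonneg S T, hasFracFactor_of_cut_nonneg G g f hgf⟩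

/-- Deleting vertices `U` and then edges, in terms of cuts of the whole graph. -/
lemma hasFracFactor_induce_iff {V : Type*} [Fintype V] [DecidableEq V]
    (G : SimpleGraph V) (g f : V → ℤ) (hgf : ∀ x, g x ≤ f x) (U : Finset V) :
    HasFracFactor (G.induce ((↑U : Set V)ᶜ)) (fun x => g x.1) (fun x => f x.1) ↔
      ∀ S T : Finset V, Disjoint S T → U ⊆ S →
        ∑ x ∈ U, f x ≤ (∑ x ∈ S, f x) - (∑ x ∈ T, g x)
          + ∑ x ∈ T, (outDegree G S x : ℤ) := by
  let ι : ((↑U : Set V)ᶜ : Set V) ↪ V := Function.Embedding.subtype _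
  refine (hasFracFactor_iff (V := ((↑U : Set V)ᶜ : Set V)) _ (fun x => g x.1) (fun x => f x.1)
    fun x => hgf x.1).trans ?_
  have key (S' T' : Finset ((↑U : Set V)ᶜ : Set V)) :
      (∑ x ∈ U ∪ S'.map ι, f x) - (∑ x ∈ T'.map ι, g x)
        + ∑ x ∈ T'.map ι, (outDegree G (U ∪ S'.map ι) x : ℤ)
      = ∑ x ∈ U, f x + ((∑ x ∈ S', f x.1) - (∑ x ∈ T', g x.1) + ∑ x ∈ T', (outDegree (G.induce ((↑U : Set V)ᶜ)) S' x : ℤ)) := by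
    have hd : Disjoint U (S'.map ι) := by
      rw [Finset.disjoint_left]
      intro x hx hx'
      obtain ⟨y, _, rfl⟩ := Finset.mem_map.1 hx'
      exact y.2 hx
    rw [sum_union hd]
    simp only [sum_map]
    have hc (x : ((↑U : Set V)ᶜ : Set V)) :
        outDegree G (U ∪ S'.map ι) (ι x) = outDegree (G.induce ((↑U : Set V)ᶜ)) S' x := by
      rw [outDegree_eq_card, outDegree_eq_card, ← Finset.card_map ι]
      congr 1
      ext y
      simp only [mem_filter, mem_univ, true_and, mem_union, mem_map, not_or]
      constructor
      · rintro ⟨ha, hU, hS⟩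
        exact ⟨⟨y, hU⟩, ⟨ha, fun h => hS ⟨_, h, rfl⟩⟩, rfl⟩
      · rintro ⟨z, ⟨ha, hS⟩, rfl⟩
        exact ⟨ha, z.2, fun ⟨z', hz', h⟩ => hS (ι.injective h ▸ hz')⟩
    simp only [hc]
    simp only [ι, Function.Embedding.subtype_apply]
    ring
  constructor
  · intro h S T hST hUS
    have hS : U ∪ (univ.filter fun x : ((↑U : Set V)ᶜ : Set V) => x.1 ∈ S).map ι = S := by
      ext x
      simp only [ι, mem_union, mem_map, mem_filter, mem_univ, true_and,
        Function.Embedding.subtype_apply]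
      constructor
      · rintro (hx | ⟨y, hy, rfl⟩)
        exacts [hUS hx, hy]
      · intro hx
        by_cases hxU : x ∈ U
        · exact Or.inl hxU
        · exact Or.inr ⟨⟨x, hxU⟩, hx, rfl⟩
    have hT : (univ.filter fun x : ((↑U : Set V)ᶜ : Set V) => x.1 ∈ T).map ι = T := by
      ext x
      simp only [ι, mem_map, mem_filter, mem_univ, true_and, Function.Embedding.subtype_apply]
      constructor
      · rintro ⟨y, hy, rfl⟩
        exact hy
      · intro hx
        exact ⟨⟨x, fun hxU => Finset.disjoint_left.1 hST (hUS hxU) hx⟩, hx, rfl⟩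
    have h' := key (univ.filter fun x => x.1 ∈ S) (univ.filter fun x => x.1 ∈ T)
    rw [hS, hT] at h'
    rw [h']
    refine le_add_of_nonneg_right (h _ _ ?_)
    rw [Finset.disjoint_filter]
    exact fun x _ hx hx' => Finset.disjoint_left.1 hST hx hx'
  · intro h S' T' hd
    have h' := h (U ∪ S'.map ι) (T'.map ι) ?_ subset_union_left
    · rw [key] at h'
      linarith
    · rw [disjoint_union_left, disjoint_map]
      refine ⟨?_, hd⟩
      rw [Finset.disjoint_left]
      intro x hx hx'
      obtain ⟨y, _, rfl⟩ := Finset.mem_map.1 hx'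
      exact y.2 hx

lemma fracDeleted_induce_iff {V : Type*} [Fintype V] [DecidableEq V]
    (G : SimpleGraph V) (g f : V → ℤ) (U : Finset V) (m : ℕ) :
    FracDeleted (G.induce ((↑U : Set V)ᶜ)) (fun x => g x.1) (fun x => f x.1) m ↔
      ∀ H : Finset (Sym2 V), (∀ e ∈ H, e ∈ G.edgeSet ∧ ∀ u ∈ U, u ∉ e) → H.card = m →
        HasFracFactor ((G.deleteEdges ↑H).induce ((↑U : Set V)ᶜ))
          (fun x => g x.1) (fun x => f x.1) := by
  let ι : Sym2 ((↑U : Set V)ᶜ : Set V) ↪ Sym2 V :=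
    ⟨Sym2.map Subtype.val, Sym2.map.injective Subtype.val_injective⟩
  have hdel (H : Finset (Sym2 ((↑U : Set V)ᶜ : Set V))) :
      (G.induce ((↑U : Set V)ᶜ)).deleteEdges ↑H
        = (G.deleteEdges ↑(H.map ι)).induce ((↑U : Set V)ᶜ) := by
    ext x y
    have : s(x.1, y.1) = ι s(x, y) := rfl
    simp only [SimpleGraph.deleteEdges_adj, SimpleGraph.comap_adj, Finset.mem_coe,
      Function.Embedding.subtype_apply, this, Finset.mem_map']
  constructor
  · intro h H hH hm
    have hHe : (univ.filter fun e => ι e ∈ H).map ι = H := by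
      ext e
      simp only [mem_map, mem_filter, mem_univ, true_and]
      constructor
      · rintro ⟨e, he, rfl⟩
        exact he
      · intro he
        obtain ⟨-, hU⟩ := hH e he
        induction e using Sym2.ind with
        | _ x y =>
          exact ⟨s(⟨x, fun hx => hU x hx (by simp)⟩, ⟨y, fun hy => hU y hy (by simp)⟩), he, rfl⟩
    have h' := h (univ.filter fun e => ι e ∈ H) ?_ (by rw [← hm, ← hHe, card_map, hHe])
    · rwa [hdel, hHe] at h'
    · intro e he
      have he' := (hH _ (Finset.mem_filter.1 he).2).1
      induction e using Sym2.ind with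
      | _ x y => exact he'
  · intro h H hH hm
    rw [hdel]
    refine h _ ?_ (by rw [card_map, hm])
    intro e he
    obtain ⟨e, -, rfl⟩ := Finset.mem_map.1 he
    have he' := hH (Finset.mem_coe.2 ((Finset.mem_map' ι).1 he))
    induction e using Sym2.ind with
    | _ x y =>
      refine ⟨he', fun u hu hue => ?_⟩
      rcases Sym2.mem_iff.1 hue with rfl | rfl
      exacts [x.2 hu, y.2 hu]

theorem statement_0 {V : Type*} [Fintype V] [DecidableEq V]
    (G : SimpleGraph V) [DecidableRel G.Adj] (g f : V → ℤ) (n' m : ℕ)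
    (hgf : ∀ x : V, 0 ≤ g x ∧ g x ≤ f x) :
    FracCriticalDeleted G g f n' m ↔
      ∀ S T : Finset V, Disjoint S T → n' ≤ S.card →
        ∀ U ⊆ S, U.card = n' →
          ∀ H : Finset (Sym2 V), (∀ e ∈ H, e ∈ G.edgeSet ∧ ∀ u ∈ U, u ∉ e) → H.card = m →
            (∑ x ∈ S, f x) - (∑ x ∈ T, g x) + ∑ x ∈ T, ((G.neighborFinset x \ S).card : ℤ)
              ≥ (∑ x ∈ U, f x) + ∑ x ∈ T, ((H.filter (fun e => x ∈ e)).card : ℤ)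
                - ((H.filter (fun e => ∃ u ∈ T, ∃ v ∈ S, e = s(u, v))).card : ℤ) := by
  have hcard (S : Finset V) (x : V) : (G.neighborFinset x \ S).card
      = outDegree G S x := by
    rw [outDegree, ← Set.ncard_coe_finset]
    congr 1
    ext y
    simp
  simp only [FracCriticalDeleted, fracDeleted_induce_iff,
    hasFracFactor_induce_iff _ g f (fun x => (hgf x).2), hcard]
  constructor
  · intro h S T hST _ U hU hUc H hH hm
    have h' := h U hUc H hH hm S T hST hU
    rw [sum_card_deleteEdges G H (fun e he => (hH e he).1) S T hST] at h'
    linarith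
  · intro h U hUc H hH hm S T hST hU
    have h' := h S T hST (hUc ▸ card_le_card hU) U hU hUc H hH hm
    rw [sum_card_deleteEdges G H (fun e he => (hH e he).1) S T hST]
    linarith
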